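/- Let K be a field of characteristic zero, let n ≥ 3, and let f ∈ K[x_1,…,x_n] be a non-constant polynomial. Then f is NCC over K if and only if the K-vector subspace of K[x_1,…,x_n] spanned by the partial derivatives ∂f/∂x_1, …, ∂f/∂x_n has dimension at least 3. -/

import Mathlib

open MvPolynomial

/-- The number of integral points of height at most `B` on the zero set of `f`. -/
noncomputable def Naff {n : ℕ} (f : MvPolynomial (Fin n) ℤ) (B : ℝ) : ℕ :=
  Set.ncard {x : Fin n → ℤ | MvPolynomial.eval x f = 0 ∧ ∀ i, (|x i| : ℝ) ≤ B}

/-- The linear form with coefficients `c`. -/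
noncomputable def linForm {K : Type*} [CommSemiring K] {n : ℕ} (c : Fin n → K) :
    MvPolynomial (Fin n) K :=
  ∑ i, MvPolynomial.C (c i) * MvPolynomial.X i

/-- `f` is NCC (not cylindrical over a curve) over `K`: it cannot be written as
`g(ℓ₁(x), ℓ₂(x))` for linear forms `ℓ₁, ℓ₂` over `K` and `g ∈ K[y₁,y₂]`. -/
def IsNCC {K : Type*} [CommSemiring K] {n : ℕ} (f : MvPolynomial (Fin n) K) : Prop :=
  ¬ ∃ (c c' : Fin n → K) (g : MvPolynomial (Fin 2) K),
      f = MvPolynomial.aeval ![linForm c, linForm c'] g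

/-- `f` is `r`-irreducible: every divisor of `f` of total degree at most `r` is a unit. -/
def RIrreducible {K : Type*} [CommSemiring K] {n : ℕ} (r : ℕ) (f : MvPolynomial (Fin n) K) : Prop :=
  ∀ g : MvPolynomial (Fin n) K, g ∣ f → g.totalDegree ≤ r → IsUnit g

/-- The chain rule for a derivation applied to the value of a multivariate polynomial. -/
theorem derivation_aeval {R A σ : Type*} [CommSemiring R] [CommSemiring A] [Algebra R A]
    [Fintype σ] (D : Derivation R A A) (s : σ → A) (f : MvPolynomial σ R) :
    D (aeval s f) = ∑ i, aeval s (pderiv i f) * D (s i) := by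
  classical
  induction f using MvPolynomial.induction_on with
  | C a => simp [MvPolynomial.algHom_C]
  | add p q hp hq => simp [hp, hq, add_mul, Finset.sum_add_distrib]
  | mul_X p j hp =>
    simp only [map_mul, aeval_X, Derivation.leibniz, smul_eq_mul, hp, pderiv_X, map_add, add_mul,
      Finset.sum_add_distrib, Finset.mul_sum]
    congr 1
    · rw [Finset.sum_eq_single j]
      · simp
      · intro i _ hij
        simp [Pi.single_eq_of_ne' hij]
      · simp
    · exact Finset.sum_congr rfl fun i _ => by ring

theorem eval_linForm {K : Type*} [CommSemiring K] {n : ℕ} (c x : Fin n → K) :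
    eval x (linForm c) = ∑ i, c i * x i := by
  simp [linForm]

theorem eval_linForm_single {K : Type*} [CommSemiring K] {n m : ℕ}
    (L : (Fin n → K) →ₗ[K] (Fin m → K)) (j : Fin m) (x : Fin n → K) :
    eval x (linForm fun i => L (Pi.single i 1) j) = L x j := by
  have hsingle (i : Fin n) : (fun k => if i = k then (1 : K) else 0) = Pi.single i 1 := by
    ext k
    simp [Pi.single_apply, eq_comm]
  rw [eval_linForm, L.pi_apply_eq_sum_univ x]
  simp only [hsingle, Finset.sum_apply, Pi.smul_apply, smul_eq_mul, mul_comm]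

theorem pderiv_linForm {K : Type*} [CommSemiring K] {n : ℕ} (c : Fin n → K) (i : Fin n) :
    pderiv i (linForm c) = C (c i) := by
  classical
  simp [linForm, pderiv_X, Pi.single_apply]

/-- A polynomial is invariant under translation by a vector along which its directional
derivative vanishes. -/
theorem eval_add_eq_of_sum_smul_pderiv_eq_zero {K σ : Type*} [Field K] [CharZero K] [Fintype σ]
    {f : MvPolynomial σ K} {v : σ → K} (hv : ∑ i, v i • pderiv i f = 0) (x : σ → K) :
    eval (x + v) f = eval x f := by
  let s : σ → Polynomial K := fun i => Polynomial.C (x i) + Polynomial.C (v i) * Polynomial.X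
  have hs (t : K) : (aeval s f).eval t = eval (fun i => x i + v i * t) f := by
    rw [← Polynomial.coe_aeval_eq_eval, ← AlgHom.comp_apply, comp_aeval, ← coe_aeval_eq_eval]
    simp [s]
  have hderiv : Polynomial.derivative (aeval s f) = 0 := by
    have h := derivation_aeval (Polynomial.derivative' (R := K)) s f
    have hsum := congrArg (aeval s) hv
    simp only [map_sum, map_smul, map_zero] at hsum
    change Polynomial.derivative (aeval s f) = _ at h
    rw [h, ← hsum]
    refine Finset.sum_congr rfl fun i _ => ?_
    change aeval s (pderiv i f) * Polynomial.derivative (s i) = _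
    rw [Polynomial.smul_eq_C_mul, mul_comm]
    simp [s]
  have hconst := Polynomial.eq_C_of_derivative_eq_zero hderiv
  have h0 := hs 0
  have h1 := hs 1
  rw [hconst, Polynomial.eval_C] at h0 h1
  simp only [mul_one, mul_zero, add_zero] at h0 h1
  exact h1.symm.trans h0

theorem finrank_span_pderiv_aeval_linForm_le {K : Type*} [Field K] {n m : ℕ}
    (c : Fin m → Fin n → K) (g : MvPolynomial (Fin m) K) :
    Module.finrank K (Submodule.span K (Set.range fun i : Fin n =>
      pderiv i (aeval (fun j => linForm (c j)) g))) ≤ m := by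
  let w : Fin m → MvPolynomial (Fin n) K := fun j => aeval (fun j => linForm (c j)) (pderiv j g)
  have hle : Submodule.span K (Set.range fun i : Fin n =>
      pderiv i (aeval (fun j => linForm (c j)) g)) ≤ Submodule.span K (Set.range w) := by
    rw [Submodule.span_le]
    rintro _ ⟨i, rfl⟩
    simp only [derivation_aeval, pderiv_linForm, mul_comm _ (C _), C_mul']
    exact Submodule.sum_mem _ fun j _ =>
      Submodule.smul_mem _ _ (Submodule.subset_span ⟨j, rfl⟩)
  have : Module.Finite K (Submodule.span K (Set.range w)) :=
    FiniteDimensional.span_of_finite K (Set.finite_range w)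
  exact (Submodule.finrank_mono hle).trans ((finrank_range_le_card w).trans_eq (Fintype.card_fin m))

theorem exists_eq_aeval_linForm_of_finrank_span_pderiv_le {K : Type*} [Field K] [CharZero K]
    {n m : ℕ} {f : MvPolynomial (Fin n) K}
    (hf : Module.finrank K (Submodule.span K (Set.range fun i : Fin n => pderiv i f)) ≤ m) :
    ∃ (c : Fin m → Fin n → K) (g : MvPolynomial (Fin m) K),
      f = aeval (fun j => linForm (c j)) g := by
  let D := Fintype.linearCombination K fun i : Fin n => pderiv i f
  rw [← Fintype.range_linearCombination] at hf
  obtain ⟨e, he⟩ : ∃ e : LinearMap.range D →ₗ[K] (Fin m → K), Function.Injective e :=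
    finrank_le_iff_exists_linearMap.mp (by simpa using hf)
  obtain ⟨r, hr⟩ := e.exists_leftInverse_of_injective (LinearMap.ker_eq_bot.mpr he)
  obtain ⟨s, hs⟩ := D.rangeRestrict.exists_rightInverse_of_surjective D.range_rangeRestrict
  let L := e ∘ₗ D.rangeRestrict
  let S := s ∘ₗ r
  have hD (x : Fin n → K) : D (x - S (L x)) = 0 := by
    have h1 := LinearMap.congr_fun hr (D.rangeRestrict x)
    have h2 := congrArg Subtype.val (LinearMap.congr_fun hs (D.rangeRestrict x))
    simp only [LinearMap.comp_apply, LinearMap.id_apply, LinearMap.codRestrict_apply,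
      LinearMap.rangeRestrict] at h1 h2
    simp only [L, S, LinearMap.comp_apply, map_sub, LinearMap.rangeRestrict, h1, h2, sub_self]
  refine ⟨fun j i => L (Pi.single i 1) j,
    aeval (fun i => linForm fun k => S (Pi.single k 1) i) f, MvPolynomial.funext fun x => ?_⟩
  have hgx : eval x (aeval (fun j => linForm fun i => L (Pi.single i 1) j)
      (aeval (fun i => linForm fun k => S (Pi.single k 1) i) f)) = eval (S (L x)) f := by
    have heval {p q : ℕ} (T : (Fin p → K) →ₗ[K] (Fin q → K)) (h : MvPolynomial (Fin q) K)
        (y : Fin p → K) :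
        eval y (aeval (fun j => linForm fun i => T (Pi.single i 1) j) h) = eval (T y) h := by
      rw [← coe_aeval_eq_eval, RingHom.coe_coe, ← AlgHom.comp_apply, comp_aeval]
      have harg : (fun j => aeval y (linForm fun i => T (Pi.single i 1) j)) = T y :=
        funext fun j => eval_linForm_single T j y
      rw [harg]
      rfl
    rw [heval, heval]
  rw [hgx, ← eval_add_eq_of_sum_smul_pderiv_eq_zero (f := f) (hD x) (S (L x)), add_sub_cancel]

/-- Over a field of characteristic zero, a non-constant `f ∈ K[x₁,…,xₙ]` with `n ≥ 3` is NCC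
over `K` iff the span of its partial derivatives has dimension at least `3`. -/
theorem isNCC_iff_span_pderiv (K : Type*) [Field K] [CharZero K] (n : ℕ) (hn : 3 ≤ n)
    (f : MvPolynomial (Fin n) K) (hf : 0 < f.totalDegree) :
    IsNCC f ↔
      3 ≤ Module.finrank K
        (Submodule.span K (Set.range fun i : Fin n => MvPolynomial.pderiv i f)) := by
  have hvec (c c' : Fin n → K) : ![linForm c, linForm c'] = fun j => linForm (![c, c'] j) := by
    ext j : 1
    fin_cases j <;> rfl
  rw [← not_lt, IsNCC, not_iff_not, Nat.lt_succ_iff]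
  constructor
  · rintro ⟨c, c', g, rfl⟩
    rw [hvec]
    exact finrank_span_pderiv_aeval_linForm_le _ g
  · intro h
    obtain ⟨c, g, hg⟩ := exists_eq_aeval_linForm_of_finrank_span_pderiv_le h
    refine ⟨c 0, c 1, g, hg.trans ?_⟩
    congr 2
    ext j : 1
    fin_cases j <;> rfl
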